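/- (Local pressure representation, double divergence form) Let Ω₁ ⊂⊂ Ω₂ ⊂⊂ Ω ⊂ ℝ³ be open sets (each compactly contained in the next) and ψ ∈ C_c^∞(Ω₂;ℝ) with ψ ≡ 1 on Ω₁. Let G^x(y) := 1/(4π|x−y|). Suppose Π ∈ C²(Ω;ℝ) and K ∈ C²(Ω;ℝ^{3×3}) satisfy −ΔΠ = Σ_{i,j} ∂_i∂_j K_{ij} pointwise in Ω. Then for every x ∈ Ω₁: Π(x) = ∫_Ω G^x(y) Σ_{i,j} ∂_i∂_j(ψK_{ij})(y) dy + ∫_Ω ( ∇_yG^x(y)⊗∇ψ(y) + ∇ψ(y)⊗∇_yG^x(y) + G^x(y)∇²ψ(y) ) : K(y) dy + ∫_Ω ( 2∇_yG^x(y)·∇ψ(y) + G^x(y)Δψ(y) ) Π(y) dy. -/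

import Mathlib

open MeasureTheory Set
open scoped ENNReal

noncomputable section

abbrev E3 : Type := EuclideanSpace ℝ (Fin 3)

/-- Partial derivative `∂_j` of a function on `ℝ³`. -/
def pd (j : Fin 3) (f : E3 → ℝ) (x : E3) : ℝ :=
  fderiv ℝ f x (EuclideanSpace.single j 1)

/-- The fundamental solution `G^x(y) = 1/(4π|x−y|)` of `−Δ` on `ℝ³`. -/
def Gfun (x y : E3) : ℝ := 1 / (4 * Real.pi * ‖x - y‖)

/-- The gradient `∇_y G^x(y) = (x−y)/(4π|x−y|³)`. -/
def dGfun (x y : E3) (j : Fin 3) : ℝ := (x j - y j) / (4 * Real.pi * ‖x - y‖ ^ 3)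

/-- `A ⊂⊂ B`: the closure of `A` is compact and contained in `B`. -/
def CptIn (A B : Set E3) : Prop := IsCompact (closure A) ∧ closure A ⊆ B

lemma pd_eq_of_hasFDerivAt {f : E3 → ℝ} {f' : E3 →L[ℝ] ℝ} {y : E3} (h : HasFDerivAt f f' y)
    (j : Fin 3) : pd j f y = f' (EuclideanSpace.single j 1) := by
  rw [pd, h.fderiv]

lemma pd_mul {f g : E3 → ℝ} {y : E3} (hf : DifferentiableAt ℝ f y) (hg : DifferentiableAt ℝ g y)
    (j : Fin 3) : pd j (fun z => f z * g z) y = pd j f y * g y + f y * pd j g y := by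
  rw [pd_eq_of_hasFDerivAt (f := fun z => f z * g z) (hf.hasFDerivAt.mul hg.hasFDerivAt)]
  simp only [pd, add_apply, smul_apply, smul_eq_mul]
  ring

lemma pd_add {f g : E3 → ℝ} {y : E3} (hf : DifferentiableAt ℝ f y) (hg : DifferentiableAt ℝ g y)
    (j : Fin 3) : pd j (fun z => f z + g z) y = pd j f y + pd j g y :=
  pd_eq_of_hasFDerivAt (hf.hasFDerivAt.add hg.hasFDerivAt) j

lemma pd_congr {f g : E3 → ℝ} {y : E3} (h : f =ᶠ[nhds y] g) (j : Fin 3) :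
    pd j f y = pd j g y := by
  rw [pd, pd, h.fderiv_eq]

lemma pd_eventuallyEq_const {f : E3 → ℝ} {x : E3} {a : ℝ} (h : f =ᶠ[nhds x] fun _ => a)
    (j : Fin 3) : pd j f =ᶠ[nhds x] fun _ => 0 := by
  filter_upwards [h.eventuallyEq_nhds] with y hy
  rw [pd_congr hy, pd, fderiv_const_apply, zero_apply]

lemma contDiff_pd {f : E3 → ℝ} {m n : WithTop ℕ∞} (hf : ContDiff ℝ n f) (hmn : m + 1 ≤ n)
    (j : Fin 3) : ContDiff ℝ m (pd j f) :=
  (hf.fderiv_right hmn).clm_apply contDiff_const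

lemma contDiffOn_pd {Ω : Set E3} (hΩ : IsOpen Ω) {f : E3 → ℝ} {m n : WithTop ℕ∞}
    (hf : ContDiffOn ℝ n f Ω) (hmn : m + 1 ≤ n) (j : Fin 3) : ContDiffOn ℝ m (pd j f) Ω :=
  (hf.fderiv_of_isOpen hΩ hmn).clm_apply contDiffOn_const

lemma tsupport_pd_subset (f : E3 → ℝ) (j : Fin 3) : tsupport (pd j f) ⊆ tsupport f :=
  tsupport_fderiv_apply_subset ℝ _

lemma HasCompactSupport.pd {f : E3 → ℝ} (hf : HasCompactSupport f) (j : Fin 3) :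
    HasCompactSupport (pd j f) :=
  hf.fderiv_apply ℝ _

lemma pd_comm {f : E3 → ℝ} (hf : ContDiff ℝ 2 f) (i j : Fin 3) (y : E3) :
    pd i (pd j f) y = pd j (pd i f) y := by
  have hd : DifferentiableAt ℝ (fderiv ℝ f) y :=
    ((hf.fderiv_right (m := 1) (by norm_num)).differentiable (by norm_num)) y
  have key : ∀ k l : Fin 3, pd k (pd l f) y =
      fderiv ℝ (fderiv ℝ f) y (EuclideanSpace.single k 1) (EuclideanSpace.single l 1) := by
    intro k l
    have h := hd.hasFDerivAt.clm_apply
      (hasFDerivAt_const (EuclideanSpace.single l (1 : ℝ) : E3) y)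
    rw [pd_eq_of_hasFDerivAt (f := pd l f) h]
    simp
  rw [key, key]
  exact (hf.contDiffAt.isSymmSndFDerivAt (by simp)) _ _

/-- Integration by parts against a compactly supported `C¹` function. -/
lemma integral_mul_pd {f g : E3 → ℝ} (hf : ContDiff ℝ 1 f) (hg : ContDiff ℝ 1 g)
    (hgc : HasCompactSupport g) (j : Fin 3) :
    ∫ y, f y * pd j g y = -∫ y, pd j f y * g y := by
  have hf' : Continuous (pd j f) := (contDiff_pd (m := 0) hf (by norm_num) j).continuous
  have hg' : Continuous (pd j g) := (contDiff_pd (m := 0) hg (by norm_num) j).continuous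
  exact integral_mul_fderiv_eq_neg_fderiv_mul_of_integrable
    ((hf'.mul hg.continuous).integrable_of_hasCompactSupport hgc.mul_left)
    ((hf.continuous.mul hg').integrable_of_hasCompactSupport (hgc.pd j).mul_left)
    ((hf.continuous.mul hg.continuous).integrable_of_hasCompactSupport hgc.mul_left)
    (fun y _ => hf.differentiable (by norm_num) y) (fun y _ => hg.differentiable (by norm_num) y)

lemma integral_pd_eq_zero {g : E3 → ℝ} (hg : ContDiff ℝ 1 g) (hgc : HasCompactSupport g)
    (j : Fin 3) : ∫ y, pd j g y = 0 := by
  simpa [pd] using integral_mul_pd (f := fun _ => 1) contDiff_const hg hgc j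

/-- `√(1 + c²|x - y|²)`, the regularisation of `c|x - y|`. -/
def regNorm (c : ℝ) (x y : E3) : ℝ := √(1 + c ^ 2 * ‖x - y‖ ^ 2)

lemma regNorm_pos (c : ℝ) (x y : E3) : 0 < regNorm c x y :=
  Real.sqrt_pos.2 (by positivity)

lemma regNorm_sq (c : ℝ) (x y : E3) : regNorm c x y ^ 2 = 1 + c ^ 2 * ‖x - y‖ ^ 2 :=
  Real.sq_sqrt (by positivity)

lemma contDiff_regNorm (c : ℝ) (x : E3) {n : WithTop ℕ∞} : ContDiff ℝ n (regNorm c x) := by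
  refine ContDiff.sqrt ?_ fun y => by positivity
  exact contDiff_const.add (contDiff_const.mul ((contDiff_const.sub contDiff_id).norm_sq ℝ))

lemma pd_comp {f : E3 → ℝ} {φ : ℝ → ℝ} {φ' : ℝ} {y : E3} (hφ : HasDerivAt φ φ' (f y))
    (hf : DifferentiableAt ℝ f y) (j : Fin 3) :
    pd j (fun z => φ (f z)) y = φ' * pd j f y :=
  pd_eq_of_hasFDerivAt (hφ.comp_hasFDerivAt y hf.hasFDerivAt) j

lemma pd_norm_sub_sq (x y : E3) (j : Fin 3) :
    pd j (fun z => ‖x - z‖ ^ 2) y = -2 * (x j - y j) := by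
  have h := ((hasFDerivAt_id y).const_sub x).norm_sq
  rw [pd_eq_of_hasFDerivAt (f := fun z => ‖x - z‖ ^ 2) h]
  simp [EuclideanSpace.inner_single_right]
  ring

lemma pd_coord_sub (x y : E3) (j : Fin 3) : pd j (fun z => x j - z j) y = -1 := by
  have h := (EuclideanSpace.proj (𝕜 := ℝ) (j : Fin 3)).hasFDerivAt (x := y)
  rw [pd_eq_of_hasFDerivAt (f := fun z => x j - z j) (h.const_sub (x j))]
  simp

lemma differentiable_norm_sub_sq (x : E3) : Differentiable ℝ (fun z : E3 => ‖x - z‖ ^ 2) :=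
  fun _ => (((differentiableAt_const x).sub differentiableAt_id).norm_sq ℝ)

lemma pd_regNorm (c : ℝ) (x y : E3) (j : Fin 3) :
    pd j (regNorm c x) y = -(c ^ 2 * (x j - y j)) / regNorm c x y := by
  have h1 : HasDerivAt (fun t : ℝ => √(1 + c ^ 2 * t))
      (c ^ 2 * 1 / (2 * regNorm c x y)) (‖x - y‖ ^ 2) :=
    (((hasDerivAt_id _).const_mul (c ^ 2)).const_add 1).sqrt (by simp only [id]; positivity)
  have := pd_comp (f := fun z => ‖x - z‖ ^ 2) h1 (differentiable_norm_sub_sq x y) j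
  rw [pd_norm_sub_sq] at this
  refine this.trans ?_
  have := (regNorm_pos c x y).ne'
  field_simp

lemma hasDerivAt_inv_pow (n : ℕ) {t : ℝ} (ht : t ≠ 0) :
    HasDerivAt (fun s : ℝ => (s ^ n)⁻¹) (-(n * t ^ (n - 1)) / (t ^ n) ^ 2) t :=
  (hasDerivAt_pow n t).inv (pow_ne_zero n ht)

lemma pd_inv_regNorm (c : ℝ) (x y : E3) (j : Fin 3) :
    pd j (fun z => (regNorm c x z)⁻¹) y = c ^ 2 * (x j - y j) * (regNorm c x y ^ 3)⁻¹ := by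
  have hw := (regNorm_pos c x y).ne'
  rw [pd_comp (hasDerivAt_inv hw) ((contDiff_regNorm c x).differentiable one_ne_zero y),
    pd_regNorm]
  field_simp

lemma laplacian_inv_regNorm (c : ℝ) (x y : E3) :
    ∑ j, pd j (pd j (fun z => (regNorm c x z)⁻¹)) y = -(3 * c ^ 2) * (regNorm c x y ^ 5)⁻¹ := by
  have hw := (regNorm_pos c x y).ne'
  have hd := (contDiff_regNorm c x).differentiable one_ne_zero y
  have key : ∀ j, pd j (pd j (fun z => (regNorm c x z)⁻¹)) y =
      c ^ 2 * (-1 * (regNorm c x y ^ 3)⁻¹ +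
        3 * c ^ 2 * (x j - y j) ^ 2 * (regNorm c x y ^ 5)⁻¹) := by
    intro j
    have e : pd j (fun z => (regNorm c x z)⁻¹) =
        fun z => (c ^ 2 * (x j - z j)) * (regNorm c x z ^ 3)⁻¹ :=
      funext fun z => pd_inv_regNorm c x z j
    have hc : DifferentiableAt ℝ (fun z : E3 => x j - z j) y := by fun_prop
    have h3 : DifferentiableAt ℝ (fun z => (regNorm c x z ^ 3)⁻¹) y :=
      (hd.pow 3).inv (pow_ne_zero 3 hw)
    have e2 : pd j (fun z : E3 => c ^ 2 * (x j - z j)) y = -c ^ 2 := by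
      rw [pd_mul (differentiableAt_const _) hc, pd_coord_sub]
      simp [pd]
    rw [e, pd_mul (hc.const_mul _) h3, e2, pd_comp (hasDerivAt_inv_pow 3 hw) hd, pd_regNorm]
    field_simp
    ring
  have hn : ‖x - y‖ ^ 2 = ∑ j, (x j - y j) ^ 2 := by
    simp [EuclideanSpace.norm_sq_eq]
  have hs := regNorm_sq c x y
  rw [hn, Fin.sum_univ_three] at hs
  rw [Fin.sum_univ_three, key, key, key]
  field_simp
  linear_combination (-3 * c ^ 2) * hs

/-- The regularised kernel tested against the Laplacian of a `C_c²` function. -/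
lemma integral_inv_regNorm_mul_laplacian {u : E3 → ℝ} (hu : ContDiff ℝ 2 u)
    (huc : HasCompactSupport u) (c : ℝ) (x : E3) :
    ∫ y, (regNorm c x y)⁻¹ * ∑ j, pd j (pd j u) y =
      ∫ y, (-(3 * c ^ 2) * (regNorm c x y ^ 5)⁻¹) * u y := by
  have hG : ∀ n : WithTop ℕ∞, ContDiff ℝ n (fun y => (regNorm c x y)⁻¹) := fun n =>
    (contDiff_regNorm c x).inv fun y => (regNorm_pos c x y).ne'
  have hG1 : ∀ (j : Fin 3) (n : WithTop ℕ∞), ContDiff ℝ 1 (pd j (fun y => (regNorm c x y)⁻¹)) :=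
    fun j _ => contDiff_pd (hG 2) (by norm_num) j
  have hu1 : ∀ j : Fin 3, ContDiff ℝ 1 (pd j u) := fun j => contDiff_pd hu (by norm_num) j
  have hu2 : ∀ j : Fin 3, Continuous (pd j (pd j u)) := fun j =>
    (contDiff_pd (m := 0) (hu1 j) (by norm_num) j).continuous
  have hG2 : ∀ j : Fin 3, Continuous (pd j (pd j (fun y => (regNorm c x y)⁻¹))) := fun j =>
    (contDiff_pd (m := 0) (hG1 j 1) (by norm_num) j).continuous
  simp_rw [← laplacian_inv_regNorm, Finset.mul_sum, Finset.sum_mul]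
  rw [integral_finsetSum, integral_finsetSum]
  · refine Finset.sum_congr rfl fun j _ => ?_
    rw [integral_mul_pd (hG 1) (hu1 j) (huc.pd j),
      integral_mul_pd (hG1 j 1) (hu.of_le (by norm_num)) huc, neg_neg]
  · exact fun j _ => ((hG2 j).mul hu.continuous).integrable_of_hasCompactSupport huc.mul_left
  · exact fun j _ => ((hG 0).continuous.mul (hu2 j)).integrable_of_hasCompactSupport
      ((huc.pd j).pd j).mul_left
lemma integral_Ioi_sq_mul_inv_sqrt_pow_five :
    ∫ r in Ioi (0 : ℝ), r ^ 2 * (√(1 + r ^ 2) ^ 5)⁻¹ = 1 / 3 := by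
  have hpos : ∀ r : ℝ, 0 < √(1 + r ^ 2) := fun r => Real.sqrt_pos.2 (by positivity)
  have hsq : ∀ r : ℝ, √(1 + r ^ 2) ^ 2 = 1 + r ^ 2 := fun r => Real.sq_sqrt (by positivity)
  have hderiv : ∀ r ∈ Ici (0 : ℝ), HasDerivAt (fun r : ℝ => (r / √(1 + r ^ 2)) ^ 3 / 3)
      (r ^ 2 * (√(1 + r ^ 2) ^ 5)⁻¹) r := by
    intro r _
    have h1 : HasDerivAt (fun r : ℝ => √(1 + r ^ 2)) (r / √(1 + r ^ 2)) r := by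
      convert ((hasDerivAt_pow 2 r).const_add 1).sqrt (by positivity) using 1
      have := (hpos r).ne'
      field_simp
      simp [mul_comm]
    refine ((((hasDerivAt_id r).div h1 (hpos r).ne').pow 3).div_const 3).congr_deriv ?_
    have := (hpos r).ne'
    simp only [Pi.div_apply, id, Nat.cast_ofNat]
    norm_num only
    field_simp
    linear_combination r ^ 2 * hsq r
  have hlim : Filter.Tendsto (fun r : ℝ => (r / √(1 + r ^ 2)) ^ 3 / 3) Filter.atTop
      (nhds (1 / 3)) := by
    have h0 : Filter.Tendsto (fun r : ℝ => √(1 - (1 + r ^ 2)⁻¹)) Filter.atTop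
        (nhds (√(1 - 0))) := by
      refine (Filter.Tendsto.const_sub 1 ?_).sqrt
      exact (Filter.tendsto_atTop_add_const_left _ 1
        (Filter.tendsto_pow_atTop two_ne_zero)).inv_tendsto_atTop
    have h1 : Filter.Tendsto (fun r : ℝ => r / √(1 + r ^ 2)) Filter.atTop (nhds 1) := by
      rw [sub_zero, Real.sqrt_one] at h0
      refine h0.congr' ?_
      filter_upwards [Filter.eventually_ge_atTop (0 : ℝ)] with r hr
      have h2 : (1 : ℝ) - (1 + r ^ 2)⁻¹ = r ^ 2 / (1 + r ^ 2) := by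
        field_simp
        ring
      rw [h2, Real.sqrt_div (sq_nonneg r), Real.sqrt_sq hr]
    simpa using (h1.pow 3).div_const 3
  rw [integral_Ioi_of_hasDerivAt_of_nonneg' hderiv (fun r _ => by positivity) hlim]
  simp

/-- The mollifier `3/(4π) (1+|z|²)^(-5/2)`, minus the Laplacian of the regularised kernel. -/
def plummer (z : E3) : ℝ := 3 / (4 * Real.pi) * (√(1 + ‖z‖ ^ 2) ^ 5)⁻¹

lemma plummer_nonneg (z : E3) : 0 ≤ plummer z := by
  unfold plummer
  positivity

lemma integral_plummer : ∫ z, plummer z = 1 := by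
  have h := integral_fun_norm_addHaar (volume : Measure E3)
    (fun r : ℝ => 3 / (4 * Real.pi) * (√(1 + r ^ 2) ^ 5)⁻¹)
  have hv : (volume : Measure E3).real (Metric.ball 0 1) = Real.pi * 4 / 3 := by
    rw [measureReal_def, EuclideanSpace.volume_ball_fin_three]
    simp only [ENNReal.ofReal_one, one_pow, one_mul]
    exact ENNReal.toReal_ofReal (by positivity)
  have hi : ∫ r in Ioi (0 : ℝ), r ^ (3 - 1) * (3 / (4 * Real.pi) * (√(1 + r ^ 2) ^ 5)⁻¹) =
      3 / (4 * Real.pi) * (1 / 3) := by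
    rw [← integral_Ioi_sq_mul_inv_sqrt_pow_five, ← integral_const_mul]
    congr 1 with r
    ring
  rw [finrank_euclideanSpace_fin] at h
  simp only [smul_eq_mul, nsmul_eq_mul, hv, hi] at h
  refine h.trans ?_
  have := Real.pi_ne_zero
  push_cast
  field_simp

lemma tendsto_norm_pow_three_mul_plummer :
    Filter.Tendsto (fun z : E3 => ‖z‖ ^ Module.finrank ℝ E3 * plummer z)
      (Bornology.cobounded E3) (nhds 0) := by
  rw [finrank_euclideanSpace_fin]
  have h1 : Filter.Tendsto (fun z : E3 => 3 / (4 * Real.pi) * (‖z‖ ^ 2)⁻¹)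
      (Bornology.cobounded E3) (nhds 0) := by
    have := ((Filter.tendsto_pow_atTop (α := ℝ) two_ne_zero).comp
      (tendsto_norm_cobounded_atTop (E := E3))).inv_tendsto_atTop.const_mul (3 / (4 * Real.pi))
    simpa using this
  refine squeeze_zero' (.of_forall fun z => mul_nonneg (by positivity) (plummer_nonneg z)) ?_ h1
  have h2 : ∀ᶠ z : E3 in Bornology.cobounded E3, 1 ≤ ‖z‖ :=
    tendsto_norm_cobounded_atTop.eventually_ge_atTop 1
  filter_upwards [h2] with z hz
  have hle : ‖z‖ ≤ √(1 + ‖z‖ ^ 2) := Real.le_sqrt_of_sq_le (by linarith)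
  have h0 : 0 < ‖z‖ := by linarith
  calc ‖z‖ ^ 3 * plummer z ≤ ‖z‖ ^ 3 * (3 / (4 * Real.pi) * (‖z‖ ^ 5)⁻¹) := by
        unfold plummer
        gcongr
    _ = 3 / (4 * Real.pi) * (‖z‖ ^ 2)⁻¹ := by
        field_simp

lemma norm_Gfun (x y : E3) : ‖Gfun x y‖ = Gfun x y :=
  Real.norm_of_nonneg (by unfold Gfun; positivity)

lemma locallyIntegrable_Gfun (x : E3) : LocallyIntegrable (Gfun x) := by
  have h0 : LocallyIntegrable (fun z : E3 => (4 * Real.pi * ‖z‖)⁻¹) := by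
    refine locallyIntegrable_of_norm_le_rpow (C := (4 * Real.pi)⁻¹) (α := 1) (μ := volume) ?_ ?_
      (.of_forall fun z => ?_) (by fun_prop)
    · rw [finrank_euclideanSpace_fin]; norm_num
    · rw [finrank_euclideanSpace_fin]; norm_num
    · rw [Real.rpow_neg_one, mul_inv, Real.norm_of_nonneg (by positivity)]
  intro y
  obtain ⟨s, hs, hi⟩ := h0 (x - y)
  refine ⟨(fun z => x - z) ⁻¹' s, (continuous_const.sub continuous_id).continuousAt hs, ?_⟩
  have := (Measure.measurePreserving_sub_left (volume : Measure E3) x).integrableOn_comp_preimage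
    (MeasurableEquiv.subLeft x).measurableEmbedding (f := fun z : E3 => (4 * Real.pi * ‖z‖)⁻¹)
    (s := s)
  have hG : Gfun x = fun y => (4 * Real.pi * ‖x - y‖)⁻¹ := funext fun y => one_div _
  rw [hG]
  exact this.2 hi

lemma integrable_Gfun_mul (x : E3) {f : E3 → ℝ} (hf : Continuous f) (hfc : HasCompactSupport f) :
    Integrable (fun y => Gfun x y * f y) :=
  (locallyIntegrable_Gfun x).integrable_smul_right_of_hasCompactSupport hf hfc

lemma hasCompactSupport_laplacian {u : E3 → ℝ} (huc : HasCompactSupport u) :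
    HasCompactSupport (fun y => ∑ j, pd j (pd j u) y) := by
  simp only [Fin.sum_univ_three]
  exact ((((huc.pd 0).pd 0).add ((huc.pd 1).pd 1)).add ((huc.pd 2).pd 2))

lemma continuous_laplacian {u : E3 → ℝ} (hu : ContDiff ℝ 2 u) :
    Continuous (fun y => ∑ j, pd j (pd j u) y) :=
  continuous_finsetSum _ fun j _ => (contDiff_pd (m := 0)
    (contDiff_pd (m := 1) hu (by norm_num) j) (by norm_num) j).continuous

/-- Green's representation of a `C_c²` function as a Newtonian potential. -/
lemma eq_neg_integral_Gfun_mul_laplacian {u : E3 → ℝ} (hu : ContDiff ℝ 2 u)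
    (huc : HasCompactSupport u) (x : E3) :
    u x = -∫ y, Gfun x y * ∑ j, pd j (pd j u) y := by
  have hΔ := continuous_laplacian hu
  have hint := integrable_Gfun_mul x hΔ (hasCompactSupport_laplacian huc)
  have hreg : ∀ c : ℝ, ∫ y, (c ^ (Module.finrank ℝ E3) * plummer (c • (x - y))) • u y =
      -∫ y, c / (4 * Real.pi) * (regNorm c x y)⁻¹ * ∑ j, pd j (pd j u) y := by
    intro c
    simp_rw [mul_assoc (c / (4 * Real.pi))]
    rw [integral_const_mul, integral_inv_regNorm_mul_laplacian hu huc, ← integral_const_mul,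
      ← integral_neg, finrank_euclideanSpace_fin]
    congr 1 with y
    have : √(1 + ‖c • (x - y)‖ ^ 2) = regNorm c x y := by
      rw [regNorm, norm_smul, mul_pow, Real.norm_eq_abs, sq_abs]
    rw [plummer, this, smul_eq_mul]
    ring
  have hbound : ∀ c : ℝ, 0 < c → ∀ y, y ≠ x →
      c / (4 * Real.pi) * (regNorm c x y)⁻¹ ≤ Gfun x y := by
    intro c hc y hy
    have hn : 0 < ‖x - y‖ := norm_sub_pos_iff.2 hy.symm
    have hle : c * ‖x - y‖ ≤ regNorm c x y :=
      Real.le_sqrt_of_sq_le (by rw [mul_pow]; linarith)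
    calc c / (4 * Real.pi) * (regNorm c x y)⁻¹ ≤ c / (4 * Real.pi) * (c * ‖x - y‖)⁻¹ := by
          gcongr
      _ = Gfun x y := by
          unfold Gfun
          field_simp
  have hne : ∀ᵐ y : E3, y ≠ x := Measure.ae_ne volume x
  have hlim1 : Filter.Tendsto
      (fun c : ℝ => ∫ y, (c ^ (Module.finrank ℝ E3) * plummer (c • (x - y))) • u y)
      Filter.atTop (nhds (u x)) :=
    tendsto_integral_comp_smul_smul_of_integrable' plummer_nonneg integral_plummer
      tendsto_norm_pow_three_mul_plummer (hu.continuous.integrable_of_hasCompactSupport huc)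
      hu.continuous.continuousAt
  have hlim2 : Filter.Tendsto
      (fun c : ℝ => ∫ y, c / (4 * Real.pi) * (regNorm c x y)⁻¹ * ∑ j, pd j (pd j u) y)
      Filter.atTop (nhds (∫ y, Gfun x y * ∑ j, pd j (pd j u) y)) := by
    refine tendsto_integral_filter_of_dominated_convergence
      (fun y => ‖Gfun x y * ∑ j, pd j (pd j u) y‖) ?_ ?_ hint.norm ?_
    · refine .of_forall fun c => Continuous.aestronglyMeasurable ?_
      exact (continuous_const.mul ((contDiff_regNorm c x (n := 0)).continuous.inv₀
        fun y => (regNorm_pos c x y).ne')).mul hΔ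
    · filter_upwards [Filter.eventually_gt_atTop 0] with c hc
      filter_upwards [hne] with y hy
      rw [norm_mul, norm_mul (Gfun x y), norm_Gfun, Real.norm_of_nonneg
        (by have := regNorm_pos c x y; positivity)]
      gcongr
      exact hbound c hc y hy
    · filter_upwards [hne] with y hy
      have hn : 0 < ‖x - y‖ := norm_sub_pos_iff.2 hy.symm
      refine Filter.Tendsto.mul_const _ ?_
      have h1 : Filter.Tendsto (fun c : ℝ => (4 * Real.pi)⁻¹ * (√((c ^ 2)⁻¹ + ‖x - y‖ ^ 2))⁻¹)
          Filter.atTop (nhds ((4 * Real.pi)⁻¹ * (√(0 + ‖x - y‖ ^ 2))⁻¹)) := by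
        refine Filter.Tendsto.const_mul _ (Filter.Tendsto.inv₀ (Filter.Tendsto.sqrt
          (Filter.Tendsto.add_const _ ?_)) ?_)
        · exact (Filter.tendsto_pow_atTop two_ne_zero).inv_tendsto_atTop
        · rw [zero_add, Real.sqrt_sq hn.le]
          exact hn.ne'
      have h2 : (4 * Real.pi)⁻¹ * (√(0 + ‖x - y‖ ^ 2))⁻¹ = Gfun x y := by
        rw [zero_add, Real.sqrt_sq hn.le, Gfun, one_div, mul_inv _ ‖x - y‖]
      rw [h2] at h1
      refine h1.congr' ?_
      filter_upwards [Filter.eventually_gt_atTop 0] with c hc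
      have h3 : regNorm c x y = c * √((c ^ 2)⁻¹ + ‖x - y‖ ^ 2) := by
        rw [regNorm, ← Real.sqrt_sq hc.le, ← Real.sqrt_mul (sq_nonneg c), Real.sqrt_sq hc.le]
        congr 1
        field_simp
      rw [h3]
      field_simp
  refine tendsto_nhds_unique hlim1 (hlim2.neg.congr fun c => (hreg c).symm)
lemma contDiffAt_norm_sub {x y : E3} (hxy : y ≠ x) {n : WithTop ℕ∞} :
    ContDiffAt ℝ n (fun z => ‖x - z‖) y :=
  (contDiffAt_const.sub contDiffAt_id).norm ℝ (sub_ne_zero.2 hxy.symm)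

lemma contDiffAt_Gfun {x y : E3} (hxy : y ≠ x) {n : WithTop ℕ∞} : ContDiffAt ℝ n (Gfun x) y :=
  contDiffAt_const.div (contDiffAt_const.mul (contDiffAt_norm_sub hxy))
    (mul_ne_zero (by positivity) (norm_sub_pos_iff.2 hxy.symm).ne')

lemma pd_Gfun {x y : E3} (hxy : y ≠ x) (j : Fin 3) : pd j (Gfun x) y = dGfun x y j := by
  have hn : ‖x - y‖ ≠ 0 := (norm_sub_pos_iff.2 hxy.symm).ne'
  have h4 : 4 * Real.pi ≠ 0 := by positivity
  have hdd := (contDiffAt_norm_sub hxy (n := 1)).differentiableAt one_ne_zero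
  have h1 : 2 * ‖x - y‖ * pd j (fun z => ‖x - z‖) y = -2 * (x j - y j) := by
    rw [← pd_norm_sub_sq,
      pd_comp (f := fun z => ‖x - z‖) (hasDerivAt_pow 2 ‖x - y‖) hdd]
    simp
  have h2 : HasDerivAt (fun t : ℝ => 1 / (4 * Real.pi * t))
      (-(4 * Real.pi * 1) / (4 * Real.pi * ‖x - y‖) ^ 2) ‖x - y‖ := by
    simp only [one_div]
    exact ((hasDerivAt_id ‖x - y‖).const_mul (4 * Real.pi)).inv (mul_ne_zero h4 hn)
  refine (pd_comp (f := fun z => ‖x - z‖) h2 hdd j).trans ?_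
  rw [dGfun]
  field_simp
  linear_combination (-1 / 2 : ℝ) * h1

/-- Away from its pole, the kernel may be multiplied by a function vanishing near the pole. -/
lemma contDiff_Gfun_mul {x : E3} {h : E3 → ℝ} {n : WithTop ℕ∞} (hh : ContDiff ℝ n h)
    (h0 : h =ᶠ[nhds x] fun _ => 0) : ContDiff ℝ n (fun y => Gfun x y * h y) := by
  refine contDiff_iff_contDiffAt.2 fun y => ?_
  rcases eq_or_ne y x with rfl | hxy
  · refine (contDiffAt_const (c := (0 : ℝ))).congr_of_eventuallyEq ?_
    filter_upwards [h0] with z hz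
    rw [hz, mul_zero]
  · exact (contDiffAt_Gfun hxy).mul hh.contDiffAt

lemma pd_Gfun_mul {x : E3} {h : E3 → ℝ} (hh : Differentiable ℝ h)
    (h0 : h =ᶠ[nhds x] fun _ => 0) (i : Fin 3) (y : E3) :
    pd i (fun y => Gfun x y * h y) y = dGfun x y i * h y + Gfun x y * pd i h y := by
  rcases eq_or_ne y x with rfl | hxy
  · have h1 : (fun z => Gfun y z * h z) =ᶠ[nhds y] fun _ => 0 := by
      filter_upwards [h0] with z hz
      rw [hz, mul_zero]
    rw [(pd_eventuallyEq_const h1 i).self_of_nhds, (pd_eventuallyEq_const h0 i).self_of_nhds,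
      h0.self_of_nhds]
    simp
  · rw [pd_mul ((contDiffAt_Gfun hxy (n := 1)).differentiableAt one_ne_zero) (hh y), pd_Gfun hxy]

section Localization

variable {Ω : Set E3} {f g : E3 → ℝ}

lemma contDiff_mul_of_tsupport_subset (hΩ : IsOpen Ω) {n : WithTop ℕ∞} (hg : ContDiff ℝ n g)
    (hgs : tsupport g ⊆ Ω) (hf : ContDiffOn ℝ n f Ω) : ContDiff ℝ n (fun y => g y * f y) := by
  refine contDiff_iff_contDiffAt.2 fun y => ?_
  by_cases hy : y ∈ Ω
  · exact hg.contDiffAt.mul (hf.contDiffAt (hΩ.mem_nhds hy))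
  · refine (contDiffAt_const (c := (0 : ℝ))).congr_of_eventuallyEq ?_
    filter_upwards [notMem_tsupport_iff_eventuallyEq.1 fun h => hy (hgs h)] with z hz
    rw [hz, Pi.zero_apply, zero_mul]

lemma setIntegral_eq_integral_of_tsupport_subset (hfs : tsupport f ⊆ Ω) :
    ∫ y in Ω, f y = ∫ y, f y :=
  setIntegral_eq_integral_of_forall_compl_eq_zero fun _ hy =>
    image_eq_zero_of_notMem_tsupport fun h => hy (hfs h)

lemma integrableOn_mul_of_tsupport_subset (hΩ : IsOpen Ω) (hg : Continuous g)
    (hgc : HasCompactSupport g) (hgs : tsupport g ⊆ Ω) (hf : ContinuousOn f Ω) :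
    IntegrableOn (fun y => g y * f y) Ω :=
  ((contDiff_mul_of_tsupport_subset hΩ (contDiff_zero.2 hg) hgs
    (contDiffOn_zero.2 hf)).continuous.integrable_of_hasCompactSupport hgc.mul_right).integrableOn

lemma setIntegral_pd_mul_add (hΩ : IsOpen Ω) (hg : ContDiff ℝ 1 g) (hgc : HasCompactSupport g)
    (hgs : tsupport g ⊆ Ω) (hf : ContDiffOn ℝ 1 f Ω) (j : Fin 3) :
    IntegrableOn (fun y => pd j g y * f y + g y * pd j f y) Ω ∧
      ∫ y in Ω, (pd j g y * f y + g y * pd j f y) = 0 := by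
  have hF := contDiff_mul_of_tsupport_subset hΩ hg hgs hf
  have hFc : HasCompactSupport (fun y => g y * f y) := hgc.mul_right
  have heq : EqOn (pd j fun y => g y * f y) (fun y => pd j g y * f y + g y * pd j f y) Ω :=
    fun y hy => pd_mul (hg.differentiable one_ne_zero y)
      ((hf.contDiffAt (hΩ.mem_nhds hy)).differentiableAt one_ne_zero) j
  have hcont : Continuous (pd j fun y => g y * f y) :=
    (contDiff_pd (m := 0) hF (by norm_num) j).continuous
  refine ⟨(hcont.integrable_of_hasCompactSupport (hFc.pd j)).integrableOn.congr_fun heq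
    hΩ.measurableSet, ?_⟩
  rw [← setIntegral_congr_fun hΩ.measurableSet heq, setIntegral_eq_integral_of_tsupport_subset
    ((tsupport_pd_subset _ j).trans ((tsupport_mul_subset_left).trans hgs)),
    integral_pd_eq_zero hF hFc]

lemma pd_pd_mul (hΩ : IsOpen Ω) (hg : ContDiff ℝ 2 g) (hf : ContDiffOn ℝ 2 f Ω) (i j : Fin 3)
    {y : E3} (hy : y ∈ Ω) :
    pd i (pd j fun z => g z * f z) y = pd i (pd j g) y * f y + pd j g y * pd i f y +
      (pd i g y * pd j f y + g y * pd i (pd j f) y) := by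
  have hfd : ∀ z ∈ Ω, DifferentiableAt ℝ f z := fun z hz =>
    (hf.contDiffAt (hΩ.mem_nhds hz)).differentiableAt two_ne_zero
  have hfd' : DifferentiableAt ℝ (pd j f) y :=
    ((contDiffOn_pd (m := 1) hΩ hf (by norm_num) j).contDiffAt
      (hΩ.mem_nhds hy)).differentiableAt one_ne_zero
  have hgd := hg.differentiable two_ne_zero
  have hgd' : Differentiable ℝ (pd j g) :=
    (contDiff_pd (m := 1) hg (by norm_num) j).differentiable one_ne_zero
  have heq : (pd j fun z => g z * f z) =ᶠ[nhds y]
      fun z => pd j g z * f z + g z * pd j f z := by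
    filter_upwards [hΩ.mem_nhds hy] with z hz
    exact pd_mul (hgd z) (hfd z hz) j
  rw [pd_congr heq, pd_add (f := fun z => pd j g z * f z) (g := fun z => g z * pd j f z)
    ((hgd' y).mul (hfd y hy)) ((hgd y).mul hfd'),
    pd_mul (hgd' y) (hfd y hy), pd_mul (hgd y) hfd']

end Localization

/-- Local representation of the pressure, double divergence form. -/
theorem stmt10 (Ω₁ Ω₂ Ω : Set E3)
    (h1o : IsOpen Ω₁) (h2o : IsOpen Ω₂) (hΩo : IsOpen Ω)
    (h12 : CptIn Ω₁ Ω₂) (h2Ω : CptIn Ω₂ Ω)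
    (ψ : E3 → ℝ) (hψs : ContDiff ℝ (⊤ : ℕ∞) ψ) (hψc : HasCompactSupport ψ)
    (hψsupp : tsupport ψ ⊆ Ω₂) (hψ1 : ∀ x ∈ Ω₁, ψ x = 1)
    (Pr : E3 → ℝ) (K : E3 → Fin 3 → Fin 3 → ℝ)
    (hPr : ContDiffOn ℝ 2 Pr Ω)
    (hK : ∀ i j : Fin 3, ContDiffOn ℝ 2 (fun y => K y i j) Ω)
    (heq : ∀ x ∈ Ω, -(∑ j, pd j (pd j Pr) x) =
      ∑ i, ∑ j, pd i (pd j (fun y => K y i j)) x) :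
    ∀ x ∈ Ω₁,
      Pr x = (∫ y in Ω, Gfun x y *
            ∑ i, ∑ j, pd i (pd j (fun w => ψ w * K w i j)) y) +
          (∫ y in Ω, ∑ i, ∑ j,
            (dGfun x y i * pd j ψ y + pd i ψ y * dGfun x y j +
              Gfun x y * pd i (pd j ψ) y) * K y i j) +
          ∫ y in Ω, (2 * (∑ j, dGfun x y j * pd j ψ y) +
            Gfun x y * ∑ j, pd j (pd j ψ) y) * Pr y := by
  intro x hx
  have hΩ₂Ω : Ω₂ ⊆ Ω := subset_closure.trans h2Ω.2
  have hψΩ : tsupport ψ ⊆ Ω := hψsupp.trans hΩ₂Ω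
  have hψn : ∀ n : ℕ, ContDiff ℝ n ψ := fun n => hψs.of_le (mod_cast le_top)
  have hψ2 : ContDiff ℝ 2 ψ := hψn 2
  have hdψ : ∀ j, ContDiff ℝ 2 (pd j ψ) := fun j => contDiff_pd (hψn 3) (by norm_num) j
  have hddψ : ∀ i j, ContDiff ℝ 1 (pd i (pd j ψ)) := fun i j =>
    contDiff_pd (hdψ j) (by norm_num) i
  have hψx : ψ =ᶠ[nhds x] fun _ => 1 := by
    filter_upwards [h1o.mem_nhds hx] with y hy using hψ1 y hy
  have hdψx : ∀ j, pd j ψ =ᶠ[nhds x] fun _ => 0 := pd_eventuallyEq_const hψx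
  have hddψx : ∀ i j, pd i (pd j ψ) =ᶠ[nhds x] fun _ => 0 := fun i j =>
    pd_eventuallyEq_const (hdψx j) i
  have hdψs : ∀ j, tsupport (pd j ψ) ⊆ Ω := fun j => (tsupport_pd_subset ψ j).trans hψΩ
  have hddψs : ∀ i j, tsupport (pd i (pd j ψ)) ⊆ Ω := fun i j =>
    (tsupport_pd_subset _ i).trans (hdψs j)
  -- `g j = G ∂_jψ` and `q i j = G ∂_i∂_jψ` are regular, since `∇ψ` vanishes near the pole `x`.
  set g : Fin 3 → E3 → ℝ := fun j y => Gfun x y * pd j ψ y with hg_def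
  set q : Fin 3 → Fin 3 → E3 → ℝ := fun i j y => Gfun x y * pd i (pd j ψ) y with hq_def
  have hg : ∀ j, ContDiff ℝ 1 (g j) := fun j =>
    (contDiff_Gfun_mul (hdψ j) (hdψx j)).of_le (by norm_num)
  have hgc : ∀ j, HasCompactSupport (g j) := fun j => (hψc.pd j).mul_left
  have hgs : ∀ j, tsupport (g j) ⊆ Ω := fun j => tsupport_mul_subset_right.trans (hdψs j)
  have hdg : ∀ i j y, pd i (g j) y = dGfun x y i * pd j ψ y + q i j y := fun i j y =>
    pd_Gfun_mul ((hdψ j).differentiable two_ne_zero) (hdψx j) i y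
  have hq : ∀ i j, Continuous (q i j) := fun i j =>
    (contDiff_Gfun_mul (hddψ i j) (hddψx i j)).continuous
  have hqc : ∀ i j, HasCompactSupport (q i j) := fun i j => ((hψc.pd j).pd i).mul_left
  have hqs : ∀ i j, tsupport (q i j) ⊆ Ω := fun i j =>
    tsupport_mul_subset_right.trans (hddψs i j)
  have hqint : ∀ i j f, ContinuousOn f Ω → IntegrableOn (fun y => q i j y * f y) Ω :=
    fun i j f hf => integrableOn_mul_of_tsupport_subset hΩo (hq i j) (hqc i j) (hqs i j) hf
  have hdgint : ∀ i j f, ContinuousOn f Ω → IntegrableOn (fun y => pd i (g j) y * f y) Ω :=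
    fun i j f hf => integrableOn_mul_of_tsupport_subset hΩo
      (contDiff_pd (m := 0) (hg j) (by norm_num) i).continuous ((hgc j).pd i)
      ((tsupport_pd_subset _ i).trans (hgs j)) hf
  have hPr1 : ContDiffOn ℝ 1 Pr Ω := hPr.of_le (by norm_num)
  have hK1 : ∀ i j, ContDiffOn ℝ 1 (fun y => K y i j) Ω := fun i j => (hK i j).of_le (by norm_num)
  have hψPr := contDiff_mul_of_tsupport_subset hΩo hψ2 hψΩ hPr
  have hψPrc : HasCompactSupport (fun y => ψ y * Pr y) := hψc.mul_right
  have hψK : ∀ i j, ContDiff ℝ 2 (fun w => ψ w * K w i j) := fun i j =>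
    contDiff_mul_of_tsupport_subset hΩo hψ2 hψΩ (hK i j)
  have hψKc : ∀ i j, HasCompactSupport (fun w => ψ w * K w i j) := fun i j => hψc.mul_right
  -- Newtonian representation of `ψ Π`.
  have hrep : Pr x = -∫ y in Ω, Gfun x y * ∑ j, pd j (pd j fun w => ψ w * Pr w) y := by
    have h := eq_neg_integral_Gfun_mul_laplacian hψPr hψPrc x
    rw [hψ1 x hx, one_mul] at h
    rw [h, setIntegral_eq_integral_of_forall_compl_eq_zero]
    intro y hy
    have h0 : (fun w => ψ w * Pr w) =ᶠ[nhds y] fun _ => 0 := by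
      filter_upwards [notMem_tsupport_iff_eventuallyEq.1 fun h => hy (hψΩ h)] with z hz
      rw [hz, Pi.zero_apply, zero_mul]
    simp [fun j => (pd_eventuallyEq_const (pd_eventuallyEq_const h0 j) j).self_of_nhds]
  have hL : IntegrableOn (fun y => Gfun x y * ∑ j, pd j (pd j fun w => ψ w * Pr w) y) Ω :=
    (integrable_Gfun_mul x (continuous_laplacian hψPr)
      (hasCompactSupport_laplacian hψPrc)).integrableOn
  have hA : IntegrableOn (fun y => Gfun x y *
      ∑ i, ∑ j, pd i (pd j (fun w => ψ w * K w i j)) y) Ω := by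
    simp_rw [Finset.mul_sum]
    refine integrable_finsetSum _ fun i _ => integrable_finsetSum _ fun j _ => ?_
    exact (integrable_Gfun_mul x (contDiff_pd (m := 0)
      (contDiff_pd (m := 1) (hψK i j) (by norm_num) j) (by norm_num) i).continuous
      (((hψKc i j).pd j).pd i)).integrableOn
  have hB : IntegrableOn (fun y => ∑ i, ∑ j, (dGfun x y i * pd j ψ y + pd i ψ y * dGfun x y j +
      Gfun x y * pd i (pd j ψ) y) * K y i j) Ω := by
    refine integrable_finsetSum _ fun i _ => integrable_finsetSum _ fun j _ => ?_
    have hc := (hK i j).continuousOn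
    refine (((hdgint i j _ hc).add (hdgint j i _ hc)).sub (hqint j i _ hc)).congr
      (.of_forall fun y => ?_)
    simp only [Pi.add_apply, Pi.sub_apply, hdg, hq_def, pd_comm hψ2 j i]
    ring
  have hC : IntegrableOn (fun y => (2 * (∑ j, dGfun x y j * pd j ψ y) +
      Gfun x y * ∑ j, pd j (pd j ψ) y) * Pr y) Ω := by
    have hc := hPr.continuousOn
    refine (integrable_finsetSum Finset.univ fun j _ =>
      ((hdgint j j _ hc).const_mul 2).sub (hqint j j _ hc)).congr (.of_forall fun y => ?_)
    simp only [Pi.sub_apply, hdg, hq_def, Fin.sum_univ_three]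
    ring
  have hv : ∀ i j (f : E3 → ℝ), ContDiffOn ℝ 1 f Ω →
      IntegrableOn (fun y => pd i (g j) y * f y + g j y * pd i f y) Ω ∧
        ∫ y in Ω, (pd i (g j) y * f y + g j y * pd i f y) = 0 := fun i j f hf =>
    setIntegral_pd_mul_add hΩo (hg j) (hgc j) (hgs j) hf i
  have hsplit : ∀ y ∈ Ω,
      Gfun x y * (∑ i, ∑ j, pd i (pd j (fun w => ψ w * K w i j)) y) +
        (∑ i, ∑ j, (dGfun x y i * pd j ψ y + pd i ψ y * dGfun x y j +
          Gfun x y * pd i (pd j ψ) y) * K y i j) +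
        (2 * (∑ j, dGfun x y j * pd j ψ y) + Gfun x y * ∑ j, pd j (pd j ψ) y) * Pr y +
        Gfun x y * (∑ j, pd j (pd j fun w => ψ w * Pr w) y) =
      (∑ i, ∑ j, ((pd i (g j) y * K y i j + g j y * pd i (fun z => K z i j) y) +
        (pd j (g i) y * K y i j + g i y * pd j (fun z => K z i j) y))) +
        ∑ j, 2 * (pd j (g j) y * Pr y + g j y * pd j Pr y) := by
    intro y hy
    have he := heq y hy
    have hgy : ∀ j, g j y = Gfun x y * pd j ψ y := fun _ => rfl
    simp only [fun i j => pd_pd_mul hΩo hψ2 (hK i j) i j hy,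
      fun j => pd_pd_mul hΩo hψ2 hPr j j hy, hdg, hgy, hq_def, Fin.sum_univ_three,
      pd_comm hψ2 1 0 y, pd_comm hψ2 2 0 y, pd_comm hψ2 2 1 y] at he ⊢
    linear_combination (-Gfun x y * ψ y) * he
  have hzero : ∫ y in Ω,
      (Gfun x y * (∑ i, ∑ j, pd i (pd j (fun w => ψ w * K w i j)) y) +
        (∑ i, ∑ j, (dGfun x y i * pd j ψ y + pd i ψ y * dGfun x y j +
          Gfun x y * pd i (pd j ψ) y) * K y i j) +
        (2 * (∑ j, dGfun x y j * pd j ψ y) + Gfun x y * ∑ j, pd j (pd j ψ) y) * Pr y +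
        Gfun x y * (∑ j, pd j (pd j fun w => ψ w * Pr w) y)) = 0 := by
    have hKint : ∀ i j, IntegrableOn (fun y =>
        ((pd i (g j) y * K y i j + g j y * pd i (fun z => K z i j) y) +
        (pd j (g i) y * K y i j + g i y * pd j (fun z => K z i j) y))) Ω := fun i j =>
      (hv i j _ (hK1 i j)).1.add (hv j i _ (hK1 i j)).1
    have hPint : ∀ j, IntegrableOn (fun y =>
        2 * (pd j (g j) y * Pr y + g j y * pd j Pr y)) Ω := fun j =>
      (hv j j _ hPr1).1.const_mul 2
    rw [setIntegral_congr_fun hΩo.measurableSet hsplit, integral_add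
      (integrable_finsetSum _ fun i _ => integrable_finsetSum _ fun j _ => hKint i j)
      (integrable_finsetSum _ fun j _ => hPint j),
      integral_finsetSum _ fun i _ => integrable_finsetSum _ fun j _ => hKint i j,
      integral_finsetSum _ fun j _ => hPint j]
    have h1 : ∀ i, ∫ y in Ω, ∑ j,
        ((pd i (g j) y * K y i j + g j y * pd i (fun z => K z i j) y) +
        (pd j (g i) y * K y i j + g i y * pd j (fun z => K z i j) y)) = 0 := by
      intro i
      rw [integral_finsetSum _ fun j _ => hKint i j]
      refine Finset.sum_eq_zero fun j _ => ?_
      rw [integral_add (hv i j _ (hK1 i j)).1 (hv j i _ (hK1 i j)).1, (hv i j _ (hK1 i j)).2,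
        (hv j i _ (hK1 i j)).2, add_zero]
    have h2 : ∀ j, ∫ y in Ω, 2 * (pd j (g j) y * Pr y + g j y * pd j Pr y) = 0 := fun j => by
      rw [integral_const_mul, (hv j j _ hPr1).2, mul_zero]
    simp [h1, h2]
  have hsum := integral_add' ((hA.add hB).add hC) hL
  rw [integral_add' (hA.add hB) hC, integral_add' hA hB] at hsum
  have := hsum.symm.trans hzero
  rw [hrep]
  linarith
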